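/- Let n ≥ 5, Z_n(x,y,z,a) be the 4-perturbed reciprocal matrix with x,y,z,a > 0, and w its Perron eigenvector. If y ≤ x and a ≤ z then w_{n-1} ≥ w_n, i.e., the edge (n-1,n) is in G_{Z_n(x,y,z,a),w}. -/

import Mathlib

/-- The reciprocal matrix `Z_n(x,y,z,a)`: all entries equal to one except
(in 1-based indexing) `(1,n-1) = y`, `(1,n) = x`, `(2,n-1) = a`, `(2,n) = z`
and the reciprocals at the transposed positions. -/
noncomputable def Zmat (n : ℕ) (x y z a : ℝ) : Matrix (Fin n) (Fin n) ℝ :=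
  fun i j =>
    if i.val = 0 ∧ j.val = n - 2 then y
    else if i.val = 0 ∧ j.val = n - 1 then x
    else if i.val = 1 ∧ j.val = n - 2 then a
    else if i.val = 1 ∧ j.val = n - 1 then z
    else if i.val = n - 2 ∧ j.val = 0 then y⁻¹
    else if i.val = n - 1 ∧ j.val = 0 then x⁻¹
    else if i.val = n - 2 ∧ j.val = 1 then a⁻¹
    else if i.val = n - 1 ∧ j.val = 1 then z⁻¹
    else 1

lemma Zmat_sub_two_apply {n : ℕ} (hn : 5 ≤ n) (x y z a : ℝ) {i : Fin n}
    (hi : i.val = n - 2) (j : Fin n) :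
    Zmat n x y z a i j =
      if j.val = 0 then y⁻¹ else if j.val = 1 then a⁻¹ else 1 := by
  have h0 : n - 2 ≠ 0 := by omega
  have h1 : n - 2 ≠ 1 := by omega
  have h2 : n - 2 ≠ n - 1 := by omega
  simp [Zmat, hi, h0, h1, h2]

lemma Zmat_sub_one_apply {n : ℕ} (hn : 5 ≤ n) (x y z a : ℝ) {i : Fin n}
    (hi : i.val = n - 1) (j : Fin n) :
    Zmat n x y z a i j =
      if j.val = 0 then x⁻¹ else if j.val = 1 then z⁻¹ else 1 := by
  have h0 : n - 1 ≠ 0 := by omega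
  have h1 : n - 1 ≠ 1 := by omega
  have h2 : n - 1 ≠ n - 2 := by omega
  simp [Zmat, hi, h0, h1, h2]

/-- If row `l` of a matrix is nonnegative with a positive entry and is dominated entrywise by
row `k`, then a positive eigenvector satisfies `w l ≤ w k`. -/
lemma Matrix.eigenvector_le_of_row_le {ι : Type*} [Fintype ι] {A : Matrix ι ι ℝ} {r : ℝ}
    {w : ι → ℝ} (hw : ∀ i, 0 < w i) (heig : A.mulVec w = r • w) {k l : ι}
    (hnonneg : ∀ j, 0 ≤ A l j) (hpos : ∃ j, 0 < A l j) (hle : ∀ j, A l j ≤ A k j) :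
    w l ≤ w k := by
  have heig' (i : ι) : ∑ j, A i j * w j = r * w i := congrFun heig i
  have hrl : 0 < r * w l := by
    obtain ⟨j, hj⟩ := hpos
    rw [← heig' l]
    exact Finset.sum_pos' (fun i _ => mul_nonneg (hnonneg i) (hw i).le)
      ⟨j, Finset.mem_univ j, mul_pos hj (hw j)⟩
  have hr : 0 < r := pos_of_mul_pos_left hrl (hw l).le
  refine le_of_mul_le_mul_left ?_ hr
  rw [← heig' l, ← heig' k]
  exact Finset.sum_le_sum fun j _ => mul_le_mul_of_nonneg_right (hle j) (hw j).le

/-- if `y ≤ x` and `a ≤ z` then `w_{n-1} ≥ w_n`, i.e. edge (n-1,n)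
is in `G_{Z_n(x,y,z,a),w}`. -/
theorem zmat_edge_nsub1_n (n : ℕ) (hn : 5 ≤ n) (x y z a : ℝ)
    (hx : 0 < x) (hy : 0 < y) (hz : 0 < z) (ha : 0 < a)
    (r : ℝ) (w : Fin n → ℝ) (hw : ∀ i, 0 < w i)
    (heig : (Zmat n x y z a).mulVec w = r • w)
    (hyx : y ≤ x) (haz : a ≤ z) :
    w ⟨n - 1, by omega⟩ ≤ w ⟨n - 2, by omega⟩ := by
  have hpos (j : Fin n) : 0 < Zmat n x y z a ⟨n - 1, by omega⟩ j := by
    rw [Zmat_sub_one_apply hn _ _ _ _ rfl]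
    split_ifs <;> positivity
  refine Matrix.eigenvector_le_of_row_le hw heig (fun j => (hpos j).le)
    ⟨_, hpos ⟨0, by omega⟩⟩ fun j => ?_
  rw [Zmat_sub_one_apply hn _ _ _ _ rfl, Zmat_sub_two_apply hn _ _ _ _ rfl]
  split_ifs
  · exact inv_anti₀ hy hyx
  · exact inv_anti₀ ha haz
  · exact le_rfl
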